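/- Let W be a symmetric and singular discrete memoryless channel with R_cr < C(W). Then for any rate R with R_cr < R < C(W) there exists a constant K₂ > 0 (depending only on W and R) such that for every blocklength N ∈ ℤ⁺, the minimum maximal error probability satisfies P_e(N,R) ≤ (K₂/√N) · exp(−N·E_r(R)). -/

import Mathlib

open Real Finset

variable {X Y : Type} [Fintype X] [Fintype Y]

/-- A discrete memoryless channel: `W x y` is the probability of output `y` given input `x`. -/
def IsDMC (W : X → Y → ℝ) : Prop :=
  (∀ x y, 0 ≤ W x y) ∧ ∀ x, ∑ y, W x y = 1

/-- A probability distribution on a finite alphabet. -/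
def IsProbDist (Q : X → ℝ) : Prop :=
  (∀ x, 0 ≤ Q x) ∧ ∑ x, Q x = 1

/-- Gallager symmetry: the output alphabet can be partitioned into classes such that within
each class every row is a permutation of every other row, and every column is a permutation
of every other column. -/
def GallagerSymmetric (W : X → Y → ℝ) : Prop :=
  ∃ cls : Y → ℕ,
    (∀ (l : ℕ) (x x' : X),
        ((Finset.univ.filter fun y => cls y = l).val.map fun y => W x y) =
        ((Finset.univ.filter fun y => cls y = l).val.map fun y => W x' y)) ∧
    (∀ y y' : Y, cls y = cls y' →
        (Finset.univ.val.map fun x => W x y) = (Finset.univ.val.map fun x => W x y'))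

/-- Singularity: whenever two inputs both give an output positive probability,
they give it the same probability. -/
def Singular (W : X → Y → ℝ) : Prop :=
  ∀ x z y, 0 < W x y * W z y → W x y = W z y

/-- Gallager's function `E_o(ρ, Q)`. -/
noncomputable def Eo (W : X → Y → ℝ) (Q : X → ℝ) (ρ : ℝ) : ℝ :=
  - Real.log (∑ y, (∑ x, Q x * W x y ^ (1 / (1 + ρ))) ^ (1 + ρ))

/-- Mutual information `I(Q; W)`. -/
noncomputable def mutualInfo (W : X → Y → ℝ) (Q : X → ℝ) : ℝ :=
  ∑ x, ∑ y, Q x * W x y * Real.log (W x y / ∑ z, Q z * W z y)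

/-- Channel capacity `C(W)`. -/
noncomputable def capacity (W : X → Y → ℝ) : ℝ :=
  sSup {r | ∃ Q, IsProbDist Q ∧ r = mutualInfo W Q}

/-- The set of values whose supremum is the sphere-packing exponent. -/
def ESPset (W : X → Y → ℝ) (R : ℝ) : Set ℝ :=
  {e | ∃ Q, IsProbDist Q ∧ ∃ ρ : ℝ, 0 ≤ ρ ∧ e = Eo W Q ρ - ρ * R}

/-- The sphere-packing exponent `E_SP(R) = max_Q sup_{ρ ≥ 0} (E_o(ρ,Q) - ρ R)`. -/
noncomputable def ESP (W : X → Y → ℝ) (R : ℝ) : ℝ := sSup (ESPset W R)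

/-- The random coding exponent `E_r(R) = max_Q max_{0 ≤ ρ ≤ 1} (E_o(ρ,Q) - ρ R)`. -/
noncomputable def Er (W : X → Y → ℝ) (R : ℝ) : ℝ :=
  sSup {e | ∃ Q, IsProbDist Q ∧ ∃ ρ : ℝ, 0 ≤ ρ ∧ ρ ≤ 1 ∧ e = Eo W Q ρ - ρ * R}

/-- `R_∞`: the supremum of rates at which the sphere-packing exponent is infinite
(i.e. the defining supremum is unbounded). -/
noncomputable def Rinf (W : X → Y → ℝ) : ℝ :=
  sSup {R | ¬ BddAbove (ESPset W R)}

/-- The critical rate `R_cr`: the smallest rate above which `E_r = E_SP`. -/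
noncomputable def Rcr (W : X → Y → ℝ) : ℝ :=
  sInf {R | ∀ R', R ≤ R' → Er W R' = ESP W R'}

/-- Number of messages of an `(N, R)` code: `⌈e^{NR}⌉`. -/
noncomputable def Mof (N : ℕ) (R : ℝ) : ℕ := ⌈Real.exp (N * R)⌉₊

/-- Error probability of message `m` for a (non-feedback) block code. -/
noncomputable def msgErrorProb (W : X → Y → ℝ) {N M : ℕ}
    (f : Fin M → Fin N → X) (φ : (Fin N → Y) → Fin M) (m : Fin M) : ℝ :=
  ∑ y ∈ Finset.univ.filter (fun y : Fin N → Y => φ y ≠ m), ∏ n, W (f m n) (y n)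

/-- Average error probability of a (non-feedback) block code. -/
noncomputable def avgErrorProb (W : X → Y → ℝ) {N M : ℕ}
    (f : Fin M → Fin N → X) (φ : (Fin N → Y) → Fin M) : ℝ :=
  (M : ℝ)⁻¹ * ∑ m, msgErrorProb W f φ m

/-- A feedback encoder, given as a function of the whole output word, is causal if the symbol
sent at time `n` depends only on the message and the outputs at times `< n`. -/
def Causal {N M : ℕ} (f : Fin M → (Fin N → Y) → Fin N → X) : Prop :=
  ∀ m y y' n, (∀ k, k < n → y k = y' k) → f m y n = f m y' n

/-- Average error probability of a feedback code. -/
noncomputable def avgErrorProbFb (W : X → Y → ℝ) {N M : ℕ}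
    (f : Fin M → (Fin N → Y) → Fin N → X) (φ : (Fin N → Y) → Fin M) : ℝ :=
  (M : ℝ)⁻¹ * ∑ m, ∑ y ∈ Finset.univ.filter (fun y : Fin N → Y => φ y ≠ m),
      ∏ n, W (f m y n) (y n)

/-- The Fejér kernel with spectrum in `[-δ, δ]`, up to normalization. -/
noncomputable def fejerKernel (δ u : ℝ) : ℝ := ∫ θ in (0 : ℝ)..δ, (δ - θ) * cos (θ * u)

lemma fejerKernel_of_ne_zero (δ : ℝ) {u : ℝ} (hu : u ≠ 0) :
    fejerKernel δ u = (1 - cos (δ * u)) / u ^ 2 := by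
  have hderiv : ∀ θ ∈ Set.uIcc 0 δ, HasDerivAt
      (fun θ => (δ - θ) * (sin (θ * u) / u) - cos (θ * u) / u ^ 2)
      ((δ - θ) * cos (θ * u)) θ := by
    intro θ _
    have h1 : HasDerivAt (fun θ : ℝ => θ * u) u θ := by
      simpa using (hasDerivAt_id θ).mul_const u
    have h2 : HasDerivAt (fun θ : ℝ => δ - θ) (-1) θ := by
      simpa using (hasDerivAt_id θ).const_sub δ
    refine ((h2.mul (h1.sin.div_const u)).sub (h1.cos.div_const (u ^ 2))).congr_deriv ?_
    field_simp
    ring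
  rw [fejerKernel, intervalIntegral.integral_eq_sub_of_hasDerivAt hderiv
    (by apply Continuous.intervalIntegrable; fun_prop)]
  simp
  ring

lemma fejerKernel_zero (δ : ℝ) : fejerKernel δ 0 = δ ^ 2 / 2 := by
  simp only [fejerKernel, mul_zero, cos_zero, mul_one]
  rw [intervalIntegral.integral_sub (by simp) (by simp)]
  simp
  ring

lemma fejerKernel_nonneg (δ u : ℝ) : 0 ≤ fejerKernel δ u := by
  rcases eq_or_ne u 0 with rfl | hu
  · rw [fejerKernel_zero]; positivity
  · rw [fejerKernel_of_ne_zero δ hu]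
    have := cos_le_one (δ * u)
    exact div_nonneg (by linarith) (sq_nonneg u)

/-- Two Fejér kernels shifted so that their zeros do not meet dominate `1 / (1 + |u|) ^ 2`. -/
lemma two_div_sq_le_fejerKernel_add {δ : ℝ} (hδ : 0 < δ) (u : ℝ) :
    2 / (|u| + π / δ) ^ 2 ≤ fejerKernel δ u + fejerKernel δ (u - π / δ) := by
  have hs : 0 < π / δ := div_pos pi_pos hδ
  have hbase : 2 / (π / δ) ^ 2 = (1 - cos (δ * (π / δ))) / (π / δ) ^ 2 := by
    rw [mul_div_cancel₀ _ hδ.ne', cos_pi]; norm_num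
  rcases eq_or_ne u 0 with rfl | hu
  · have h := fejerKernel_of_ne_zero δ (neg_ne_zero.2 hs.ne')
    rw [mul_neg, cos_neg, neg_sq, ← hbase] at h
    simp only [abs_zero, zero_add, zero_sub]
    linarith [fejerKernel_nonneg δ 0]
  rcases eq_or_ne u (π / δ) with rfl | hu'
  · have h := fejerKernel_of_ne_zero δ hs.ne'
    rw [← hbase] at h
    rw [h, sub_self]
    have : 2 / (|π / δ| + π / δ) ^ 2 ≤ 2 / (π / δ) ^ 2 := by
      gcongr
      linarith [abs_nonneg (π / δ)]
    linarith [fejerKernel_nonneg δ 0]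
  have hu2 : u - π / δ ≠ 0 := sub_ne_zero.2 hu'
  rw [fejerKernel_of_ne_zero δ hu, fejerKernel_of_ne_zero δ hu2, mul_sub,
    mul_div_cancel₀ _ hδ.ne', cos_sub_pi]
  have hle1 : u ^ 2 ≤ (|u| + π / δ) ^ 2 := by
    rw [← sq_abs u]; gcongr; linarith
  have hle2 : (u - π / δ) ^ 2 ≤ (|u| + π / δ) ^ 2 := by
    rw [← sq_abs (u - π / δ)]; gcongr
    calc |u - π / δ| ≤ |u| + |π / δ| := abs_sub _ _
      _ = _ := by rw [abs_of_pos hs]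
  have hc1 := cos_le_one (δ * u)
  have hc2 := neg_one_le_cos (δ * u)
  calc 2 / (|u| + π / δ) ^ 2
      = (1 - cos (δ * u)) / (|u| + π / δ) ^ 2 + (1 - -cos (δ * u)) / (|u| + π / δ) ^ 2 := by
        rw [← add_div]; ring
    _ ≤ _ := by
        apply add_le_add
        · exact div_le_div_of_nonneg_left (by linarith) (by positivity) hle1
        · exact div_le_div_of_nonneg_left (by linarith) (by positivity) hle2

lemma exp_neg_mul_abs_le_fejerKernel {δ c : ℝ} (hδ : 0 < δ) (hc : 0 < c) (u : ℝ) :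
    exp (-(c * |u|)) ≤
      exp (c * (π / δ)) / c ^ 2 * (fejerKernel δ u + fejerKernel δ (u - π / δ)) := by
  have hs : 0 < π / δ := div_pos pi_pos hδ
  have hv : 0 < |u| + π / δ := by positivity
  have hq := quadratic_le_exp_of_nonneg (x := c * (|u| + π / δ)) (by positivity)
  have hexp : exp (-(c * (|u| + π / δ))) ≤ 2 / (c ^ 2 * (|u| + π / δ) ^ 2) := by
    rw [exp_neg, inv_eq_one_div, div_le_div_iff₀ (exp_pos _) (by positivity)]
    have : 0 < c * (|u| + π / δ) := by positivity
    nlinarith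
  calc exp (-(c * |u|)) = exp (c * (π / δ)) * exp (-(c * (|u| + π / δ))) := by
        rw [← exp_add]; ring_nf
    _ ≤ exp (c * (π / δ)) * (2 / (c ^ 2 * (|u| + π / δ) ^ 2)) := by gcongr
    _ = exp (c * (π / δ)) / c ^ 2 * (2 / (|u| + π / δ) ^ 2) := by field_simp
    _ ≤ _ := by
        gcongr
        exact two_div_sq_le_fejerKernel_add hδ u

/-- The characteristic function of a finitely supported law. -/
noncomputable def finCharFun (p ξ : Y → ℝ) (θ : ℝ) : ℂ :=
  ∑ y, (p y : ℂ) * Complex.exp ((θ * ξ y : ℝ) * Complex.I)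

lemma normSq_finCharFun (p ξ : Y → ℝ) (θ : ℝ) :
    ‖finCharFun p ξ θ‖ ^ 2 = ∑ z : Y × Y, p z.1 * p z.2 * cos (θ * (ξ z.1 - ξ z.2)) := by
  have hre : (finCharFun p ξ θ).re = ∑ y, p y * cos (θ * ξ y) := by
    simp only [finCharFun, Complex.re_sum, Complex.re_ofReal_mul, Complex.exp_ofReal_mul_I_re]
  have him : (finCharFun p ξ θ).im = ∑ y, p y * sin (θ * ξ y) := by
    simp only [finCharFun, Complex.im_sum, Complex.im_ofReal_mul, Complex.exp_ofReal_mul_I_im]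
  rw [← Complex.normSq_eq_norm_sq, Complex.normSq_apply, hre, him, Fintype.sum_mul_sum,
    Fintype.sum_mul_sum, ← Finset.sum_add_distrib, Fintype.sum_prod_type]
  refine Finset.sum_congr rfl fun y _ => ?_
  rw [← Finset.sum_add_distrib]
  refine Finset.sum_congr rfl fun z _ => ?_
  rw [mul_sub, cos_sub]
  ring

lemma norm_finCharFun_le_exp {p ξ : Y → ℝ} (hp : IsProbDist p) {y₁ y₂ : Y}
    {θ : ℝ} (hθ : |θ * (ξ y₁ - ξ y₂)| ≤ π) :
    ‖finCharFun p ξ θ‖ ≤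
      exp (-(p y₁ * p y₂ * (ξ y₁ - ξ y₂) ^ 2 / π ^ 2) * θ ^ 2) := by
  set κ := p y₁ * p y₂ * (ξ y₁ - ξ y₂) ^ 2 / π ^ 2 with hκ
  have htot : ∑ z : Y × Y, p z.1 * p z.2 = 1 := by
    rw [Fintype.sum_prod_type]
    simp only
    rw [← Fintype.sum_mul_sum, hp.2, one_mul]
  have hterm : p y₁ * p y₂ * (1 - cos (θ * (ξ y₁ - ξ y₂))) ≤
      ∑ z : Y × Y, p z.1 * p z.2 * (1 - cos (θ * (ξ z.1 - ξ z.2))) :=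
    Finset.single_le_sum (f := fun z : Y × Y => p z.1 * p z.2 * (1 - cos (θ * (ξ z.1 - ξ z.2))))
      (fun z _ => mul_nonneg (mul_nonneg (hp.1 _) (hp.1 _)) (sub_nonneg.2 (cos_le_one _)))
      (Finset.mem_univ (y₁, y₂))
  have hcos := cos_le_one_sub_mul_cos_sq hθ
  have hpp : 0 ≤ p y₁ * p y₂ := mul_nonneg (hp.1 _) (hp.1 _)
  have hlow : 2 * (κ * θ ^ 2) ≤ p y₁ * p y₂ * (1 - cos (θ * (ξ y₁ - ξ y₂))) := by
    calc 2 * (κ * θ ^ 2) = p y₁ * p y₂ * (2 / π ^ 2 * (θ * (ξ y₁ - ξ y₂)) ^ 2) := by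
          rw [hκ]; ring
      _ ≤ _ := by gcongr; linarith
  have hsq : ‖finCharFun p ξ θ‖ ^ 2 ≤ exp (-κ * θ ^ 2) ^ 2 := by
    rw [normSq_finCharFun, ← exp_nat_mul]
    have h1 : ∑ z : Y × Y, p z.1 * p z.2 * (1 - cos (θ * (ξ z.1 - ξ z.2))) =
        1 - ∑ z : Y × Y, p z.1 * p z.2 * cos (θ * (ξ z.1 - ξ z.2)) := by
      conv_rhs => rw [← htot, ← Finset.sum_sub_distrib]
      exact Finset.sum_congr rfl fun z _ => by ring
    have h2 := one_sub_le_exp_neg (2 * (κ * θ ^ 2))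
    have h3 : exp (((2 : ℕ) : ℝ) * (-κ * θ ^ 2)) = exp (-(2 * (κ * θ ^ 2))) := by
      congr 1; push_cast; ring
    rw [h3]
    linarith
  exact le_of_sq_le_sq hsq (exp_nonneg _)

lemma sum_prod_mul_cos_le (p ξ : Y → ℝ) (N : ℕ) (t θ : ℝ) :
    ∑ y : Fin N → Y, (∏ n, p (y n)) * cos (θ * (∑ n, ξ (y n) - t)) ≤
      ‖finCharFun p ξ θ‖ ^ N := by
  have h : ∑ y : Fin N → Y, (∏ n, p (y n)) * cos (θ * (∑ n, ξ (y n) - t)) =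
      (Complex.exp ((-(θ * t) : ℝ) * Complex.I) * finCharFun p ξ θ ^ N).re := by
    rw [finCharFun, Fintype.sum_pow, Finset.mul_sum, Complex.re_sum]
    refine Finset.sum_congr rfl fun y _ => ?_
    rw [Finset.prod_mul_distrib, ← Complex.exp_sum, mul_left_comm, ← Complex.exp_add,
      ← Finset.sum_mul, ← add_mul, ← Complex.ofReal_prod, ← Complex.ofReal_sum,
      ← Complex.ofReal_add, Complex.re_ofReal_mul, Complex.exp_ofReal_mul_I_re, ← Finset.mul_sum]
    ring_nf
  rw [h]
  refine (Complex.re_le_norm _).trans ?_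
  rw [norm_mul, Complex.norm_exp_ofReal_mul_I, one_mul, norm_pow]

lemma sum_prod_mul_fejerKernel_le {p ξ : Y → ℝ} (hp : IsProbDist p) {y₁ y₂ : Y}
    (h₁ : 0 < p y₁) (h₂ : 0 < p y₂) (hξ : ξ y₁ ≠ ξ y₂) {N : ℕ} (hN : 0 < N) (t : ℝ) :
    ∑ y : Fin N → Y, (∏ n, p (y n)) * fejerKernel (π / |ξ y₁ - ξ y₂|) (∑ n, ξ (y n) - t) ≤
      π / |ξ y₁ - ξ y₂| * √(π / (p y₁ * p y₂ * (ξ y₁ - ξ y₂) ^ 2 / π ^ 2)) / √N := by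
  set κ := p y₁ * p y₂ * (ξ y₁ - ξ y₂) ^ 2 / π ^ 2 with hκ
  have hd : 0 < |ξ y₁ - ξ y₂| := abs_pos.2 (sub_ne_zero.2 hξ)
  set δ := π / |ξ y₁ - ξ y₂| with hδdef
  have hδ : 0 < δ := div_pos pi_pos hd
  have hκ0 : 0 < κ := by
    have : 0 < (ξ y₁ - ξ y₂) ^ 2 := by rw [← sq_abs]; positivity
    rw [hκ]; positivity
  have hN' : (0 : ℝ) < N := by exact_mod_cast hN
  have hint := integrable_exp_neg_mul_sq (mul_pos hN' hκ0)
  have hsum : ∑ y : Fin N → Y, (∏ n, p (y n)) * fejerKernel δ (∑ n, ξ (y n) - t) =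
      ∫ θ in (0 : ℝ)..δ, (δ - θ) *
        ∑ y : Fin N → Y, (∏ n, p (y n)) * cos (θ * (∑ n, ξ (y n) - t)) := by
    simp only [fejerKernel, Finset.mul_sum]
    rw [intervalIntegral.integral_finsetSum
      (fun y _ => by apply Continuous.intervalIntegrable; fun_prop)]
    refine Finset.sum_congr rfl fun y _ => ?_
    rw [← intervalIntegral.integral_const_mul]
    congr 1 with θ
    ring
  rw [hsum]
  calc _ ≤ ∫ θ in (0 : ℝ)..δ, δ * exp (-(N * κ) * θ ^ 2) := by
        apply intervalIntegral.integral_mono_on hδ.le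
        · apply Continuous.intervalIntegrable; fun_prop
        · apply Continuous.intervalIntegrable; fun_prop
        intro θ hθ
        have hθd : |θ * (ξ y₁ - ξ y₂)| ≤ π := by
          rw [abs_mul, abs_of_nonneg hθ.1]
          calc θ * |ξ y₁ - ξ y₂| ≤ δ * |ξ y₁ - ξ y₂| := by gcongr; exact hθ.2
            _ = π := div_mul_cancel₀ _ hd.ne'
        have hb : ‖finCharFun p ξ θ‖ ^ N ≤ exp (-(N * κ) * θ ^ 2) := by
          calc ‖finCharFun p ξ θ‖ ^ N ≤ exp (-κ * θ ^ 2) ^ N := by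
                gcongr
                exact norm_finCharFun_le_exp hp hθd
            _ = _ := by rw [← exp_nat_mul]; ring_nf
        calc _ ≤ (δ - θ) * exp (-(N * κ) * θ ^ 2) :=
              mul_le_mul_of_nonneg_left ((sum_prod_mul_cos_le p ξ N t θ).trans hb)
                (sub_nonneg.2 hθ.2)
          _ ≤ _ := by gcongr; linarith [hθ.1]
    _ = δ * ∫ θ in (0 : ℝ)..δ, exp (-(N * κ) * θ ^ 2) :=
        intervalIntegral.integral_const_mul _ _
    _ ≤ δ * √(π / (N * κ)) := by
        gcongr
        rw [← integral_gaussian, intervalIntegral.integral_of_le hδ.le]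
        exact MeasureTheory.setIntegral_le_integral hint
          (Filter.Eventually.of_forall fun _ => (exp_pos _).le)
    _ = _ := by
        rw [show π / (N * κ) = π / κ / N by field_simp, sqrt_div (by positivity), mul_div_assoc]

/-- Concentration bound: for a nondegenerate finitely supported law, the `N`-fold sum is
spread at scale `√N`, uniformly in the location. -/
lemma exists_sum_prod_mul_exp_neg_abs_le {p ξ : Y → ℝ} (hp : IsProbDist p) {y₁ y₂ : Y}
    (h₁ : 0 < p y₁) (h₂ : 0 < p y₂) (hξ : ξ y₁ ≠ ξ y₂) {c : ℝ} (hc : 0 < c) :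
    ∃ K : ℝ, 0 < K ∧ ∀ N : ℕ, 0 < N → ∀ t : ℝ,
      ∑ y : Fin N → Y, (∏ n, p (y n)) * exp (-(c * |∑ n, ξ (y n) - t|)) ≤ K / √N := by
  have hd : 0 < |ξ y₁ - ξ y₂| := abs_pos.2 (sub_ne_zero.2 hξ)
  have hd2 : 0 < (ξ y₁ - ξ y₂) ^ 2 := by rw [← sq_abs]; positivity
  set δ := π / |ξ y₁ - ξ y₂| with hδdef
  have hδ : 0 < δ := div_pos pi_pos hd
  set A := exp (c * (π / δ)) / c ^ 2 with hA
  set B := δ * √(π / (p y₁ * p y₂ * (ξ y₁ - ξ y₂) ^ 2 / π ^ 2)) with hB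
  refine ⟨A * (B + B), by positivity, fun N hN t => ?_⟩
  have hP : ∀ y : Fin N → Y, 0 ≤ ∏ n, p (y n) := fun y => Finset.prod_nonneg fun n _ => hp.1 _
  calc _ ≤ ∑ y : Fin N → Y, (∏ n, p (y n)) * (A * (fejerKernel δ (∑ n, ξ (y n) - t) +
          fejerKernel δ (∑ n, ξ (y n) - t - π / δ))) :=
        Finset.sum_le_sum fun y _ =>
          mul_le_mul_of_nonneg_left (exp_neg_mul_abs_le_fejerKernel hδ hc _) (hP y)
    _ = A * (∑ y : Fin N → Y, (∏ n, p (y n)) * fejerKernel δ (∑ n, ξ (y n) - t) +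
          ∑ y : Fin N → Y, (∏ n, p (y n)) * fejerKernel δ (∑ n, ξ (y n) - (t + π / δ))) := by
        rw [← Finset.sum_add_distrib, Finset.mul_sum]
        refine Finset.sum_congr rfl fun y _ => ?_
        rw [sub_sub]
        ring
    _ ≤ A * (B / √N + B / √N) := by
        gcongr
        · exact sum_prod_mul_fejerKernel_le hp h₁ h₂ hξ hN t
        · exact sum_prod_mul_fejerKernel_le hp h₁ h₂ hξ hN (t + π / δ)
    _ = _ := by ring

/-- The output distribution induced by the uniform input distribution. -/
noncomputable def unifOutput (W : X → Y → ℝ) (y : Y) : ℝ := (∑ x, W x y) / Fintype.card X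

open Classical in
/-- The fraction of inputs from which the output `y` can be reached. -/
noncomputable def reachFraction (W : X → Y → ℝ) (y : Y) : ℝ :=
  ((Finset.univ.filter fun x => 0 < W x y).card : ℝ) / Fintype.card X

lemma reachFraction_nonneg {X Y : Type} [Fintype X] (W : X → Y → ℝ) (y : Y) : 0 ≤ reachFraction W y := by
  unfold reachFraction; positivity

lemma inv_card_le_reachFraction {X Y : Type} [Fintype X] [Nonempty X] {W : X → Y → ℝ} {x : X} {y : Y} (h : 0 < W x y) :
    (Fintype.card X : ℝ)⁻¹ ≤ reachFraction W y := by
  classical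
  have h1 : 0 < (Finset.univ.filter fun x => 0 < W x y).card :=
    Finset.card_pos.2 ⟨x, by simpa using h⟩
  have h2 : (1 : ℝ) ≤ ((Finset.univ.filter fun x => 0 < W x y).card : ℝ) := by exact_mod_cast h1
  rw [reachFraction, inv_eq_one_div]
  gcongr

lemma reachFraction_pos {X Y : Type} [Fintype X] [Nonempty X] {W : X → Y → ℝ} {x : X} {y : Y} (h : 0 < W x y) :
    0 < reachFraction W y :=
  lt_of_lt_of_le (by positivity) (inv_card_le_reachFraction h)

lemma unifOutput_isProbDist [Nonempty X] {W : X → Y → ℝ} (hW : IsDMC W) :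
    IsProbDist (unifOutput W) := by
  refine ⟨fun y => div_nonneg (Finset.sum_nonneg fun x _ => hW.1 x y) (by positivity), ?_⟩
  simp only [unifOutput]
  rw [← Finset.sum_div, Finset.sum_comm]
  simp [hW.2]

lemma exists_pos_of_unifOutput_pos {X Y : Type} [Fintype X] {W : X → Y → ℝ} {y : Y} (h : 0 < unifOutput W y) :
    ∃ x, 0 < W x y := by
  by_contra! hc
  have : unifOutput W y ≤ 0 :=
    div_nonpos_of_nonpos_of_nonneg (Finset.sum_nonpos fun x _ => hc x) (by positivity)
  linarith

/-- For a singular channel, Bayes' rule reads `q(y) = W(y|x) s(y)` on the support. -/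
lemma unifOutput_eq_mul_reachFraction {W : X → Y → ℝ} (hW : IsDMC W) (hsing : Singular W)
    {x : X} {y : Y} (h : 0 < W x y) : unifOutput W y = W x y * reachFraction W y := by
  classical
  have hsum : ∑ z, W z y = ∑ z, if 0 < W z y then W x y else 0 := by
    refine Finset.sum_congr rfl fun z _ => ?_
    split_ifs with hz
    · exact (hsing x z y (mul_pos h hz)).symm
    · exact le_antisymm (not_lt.1 hz) (hW.1 z y)
  rw [unifOutput, hsum, ← Finset.sum_filter, Finset.sum_const, nsmul_eq_mul, reachFraction]
  ring_nf

lemma reachFraction_eq_of_cls {X Y : Type} [Fintype X] {W : X → Y → ℝ} {y y' : Y}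
    (h : (Finset.univ.val.map fun x => W x y) = (Finset.univ.val.map fun x => W x y')) :
    reachFraction W y = reachFraction W y' := by
  classical
  have key : ∀ y, (Finset.univ.filter fun x => 0 < W x y).card =
      ((Finset.univ.val.map fun x => W x y).filter (0 < ·)).card := by
    intro y
    rw [Multiset.filter_map, Multiset.card_map]
    rfl
  have := key y
  rw [h, ← key y'] at this
  unfold reachFraction
  congr 2

/-- The law of the reachable fraction at the output does not depend on the input. -/
lemma sum_mul_comp_reachFraction [Nonempty X] {W : X → Y → ℝ} (hsym : GallagerSymmetric W)
    (h : ℝ → ℝ) (x : X) :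
    ∑ y, W x y * h (reachFraction W y) = ∑ y, unifOutput W y * h (reachFraction W y) := by
  classical
  obtain ⟨cls, hrow, hcol⟩ := hsym
  have hxx : ∀ x x' : X, ∑ y, W x y * h (reachFraction W y) =
      ∑ y, W x' y * h (reachFraction W y) := by
    intro x x'
    rw [← Finset.sum_fiberwise_of_maps_to (g := cls) (t := Finset.univ.image cls)
        (fun y _ => Finset.mem_image_of_mem _ (Finset.mem_univ y)),
      ← Finset.sum_fiberwise_of_maps_to (g := cls) (t := Finset.univ.image cls)
        (fun y _ => Finset.mem_image_of_mem _ (Finset.mem_univ y))]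
    refine Finset.sum_congr rfl fun l hl => ?_
    obtain ⟨y₀, -, rfl⟩ := Finset.mem_image.1 hl
    have hc : ∀ x : X, ∑ y with cls y = cls y₀, W x y * h (reachFraction W y) =
        (∑ y with cls y = cls y₀, W x y) * h (reachFraction W y₀) := by
      intro x
      rw [Finset.sum_mul]
      refine Finset.sum_congr rfl fun y hy => ?_
      rw [reachFraction_eq_of_cls (hcol y y₀ (Finset.mem_filter.1 hy).2)]
    rw [hc, hc]
    congr 1
    exact congrArg Multiset.sum (hrow (cls y₀) x x')
  have hcard : (Fintype.card X : ℝ) ≠ 0 := by positivity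
  have : ∑ y, unifOutput W y * h (reachFraction W y) =
      (∑ x', ∑ y, W x' y * h (reachFraction W y)) / Fintype.card X := by
    rw [Finset.sum_comm, Finset.sum_div]
    refine Finset.sum_congr rfl fun y _ => ?_
    rw [unifOutput, ← Finset.sum_mul]
    ring
  rw [this, Finset.sum_congr rfl fun x' _ => hxx x' x]
  simp [hcard]

/-- If two families of weights give the same law to `s` coordinatewise, then they give the same
law to the product of the `s`. -/
lemma sum_prod_mul_comp_prod_eq {s b : Y → ℝ} {N : ℕ} {a : Fin N → Y → ℝ}
    (hab : ∀ n, ∀ h : ℝ → ℝ, ∑ y, a n y * h (s y) = ∑ y, b y * h (s y)) (h : ℝ → ℝ) :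
    ∑ y : Fin N → Y, (∏ n, a n (y n)) * h (∏ n, s (y n)) =
      ∑ y : Fin N → Y, (∏ n, b (y n)) * h (∏ n, s (y n)) := by
  induction N generalizing h with
  | zero => simp
  | succ N ih =>
    have hsplit : ∀ c : Fin (N + 1) → Y → ℝ,
        ∑ y : Fin (N + 1) → Y, (∏ n, c n (y n)) * h (∏ n, s (y n)) =
        ∑ y₀, c 0 y₀ * ∑ y : Fin N → Y, (∏ n, c n.succ (y n)) * h (s y₀ * ∏ n, s (y n)) := by
      intro c
      rw [← (Fin.consEquiv fun _ : Fin (N + 1) => Y).sum_comp, Fintype.sum_prod_type]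
      refine Finset.sum_congr rfl fun y₀ _ => ?_
      rw [Finset.mul_sum]
      refine Finset.sum_congr rfl fun y _ => ?_
      simp [Fin.consEquiv, Fin.prod_univ_succ, mul_assoc]
    rw [hsplit, hsplit fun _ => b]
    calc _ = ∑ y₀, a 0 y₀ * ∑ y : Fin N → Y, (∏ n, b (y n)) * h (s y₀ * ∏ n, s (y n)) := by
          refine Finset.sum_congr rfl fun y₀ _ => ?_
          rw [ih (fun n => hab n.succ) fun r => h (s y₀ * r)]
      _ = _ := hab 0 fun r => ∑ y : Fin N → Y, (∏ n, b (y n)) * h (r * ∏ n, s (y n))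

/-- The bound on the error probability of a random code of size `B` over a singular symmetric
channel. -/
noncomputable def unionBound (W : X → Y → ℝ) (N : ℕ) (B : ℝ) : ℝ :=
  ∑ y : Fin N → Y, (∏ n, unifOutput W (y n)) * min 1 (B * ∏ n, reachFraction W (y n))

open Classical in
/-- Uniformly over previously chosen words `g j`, a uniformly random word is confused with an
earlier one with probability at most the union bound. -/
lemma sum_unifOutput_confusable_le [Nonempty X] {W : X → Y → ℝ} (hW : IsDMC W)
    (hsym : GallagerSymmetric W) (hsing : Singular W) {N k : ℕ} {B : ℝ} (hkB : (k : ℝ) ≤ B)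
    (g : ℕ → Fin N → X) :
    ∑ y : Fin N → Y, (∏ n, unifOutput W (y n)) *
      (if ∃ j < k, 0 < ∏ n, W (g j n) (y n) then 1 else 0) ≤ unionBound W N B := by
  have hq : ∀ y : Fin N → Y, 0 ≤ ∏ n, unifOutput W (y n) :=
    fun y => Finset.prod_nonneg fun n _ => (unifOutput_isProbDist hW).1 _
  have hs : ∀ y : Fin N → Y, 0 ≤ ∏ n, reachFraction W (y n) :=
    fun y => Finset.prod_nonneg fun n _ => reachFraction_nonneg W _
  have hWn : ∀ (x : Fin N → X) (y : Fin N → Y), 0 ≤ ∏ n, W (x n) (y n) :=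
    fun x y => Finset.prod_nonneg fun n _ => hW.1 _ _
  set H : ℝ → ℝ := fun r => if B * r < 1 then r else 0 with hH
  have hH0 : ∀ r, 0 ≤ r → 0 ≤ H r := fun r hr => by
    simp only [hH]; split_ifs <;> simp [hr]
  have hpoint : ∀ y : Fin N → Y, (∏ n, unifOutput W (y n)) *
      (if ∃ j < k, 0 < ∏ n, W (g j n) (y n) then 1 else 0) ≤
      (∏ n, unifOutput W (y n)) * (if B * ∏ n, reachFraction W (y n) < 1 then 0 else 1) +
      ∑ j ∈ Finset.range k, (∏ n, W (g j n) (y n)) * H (∏ n, reachFraction W (y n)) := by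
    intro y
    have hsum0 : 0 ≤ ∑ j ∈ Finset.range k,
        (∏ n, W (g j n) (y n)) * H (∏ n, reachFraction W (y n)) :=
      Finset.sum_nonneg fun j _ => mul_nonneg (hWn _ _) (hH0 _ (hs y))
    by_cases hB : B * ∏ n, reachFraction W (y n) < 1
    · by_cases hj : ∃ j < k, 0 < ∏ n, W (g j n) (y n)
      · obtain ⟨j, hjk, hj'⟩ := hj
        have hpos : ∀ n, 0 < W (g j n) (y n) := fun n =>
          lt_of_le_of_ne (hW.1 _ _) fun h0 =>
            hj'.ne' (Finset.prod_eq_zero (Finset.mem_univ n) h0.symm)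
        have heq : ∏ n, unifOutput W (y n) =
            (∏ n, W (g j n) (y n)) * H (∏ n, reachFraction W (y n)) := by
          simp only [hH, if_pos hB]
          rw [← Finset.prod_mul_distrib]
          exact Finset.prod_congr rfl fun n _ =>
            unifOutput_eq_mul_reachFraction hW hsing (hpos n)
        rw [if_pos ⟨j, hjk, hj'⟩, if_pos hB, mul_one, mul_zero, zero_add, heq]
        exact Finset.single_le_sum
          (f := fun j => (∏ n, W (g j n) (y n)) * H (∏ n, reachFraction W (y n)))
          (fun j _ => mul_nonneg (hWn _ _) (hH0 _ (hs y))) (Finset.mem_range.2 hjk)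
      · rw [if_neg hj, if_pos hB]
        simpa using hsum0
    · rw [if_neg hB]
      have : (∏ n, unifOutput W (y n)) *
          (if ∃ j < k, 0 < ∏ n, W (g j n) (y n) then 1 else 0) ≤
          (∏ n, unifOutput W (y n)) * 1 := by
        gcongr
        · exact hq y
        · split_ifs <;> norm_num
      linarith
  have hlaw : ∀ j, ∑ y : Fin N → Y, (∏ n, W (g j n) (y n)) * H (∏ n, reachFraction W (y n)) =
      ∑ y : Fin N → Y, (∏ n, unifOutput W (y n)) * H (∏ n, reachFraction W (y n)) := fun j =>
    sum_prod_mul_comp_prod_eq (a := fun n => W (g j n))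
      (fun n h => sum_mul_comp_reachFraction hsym h (g j n)) H
  refine (Finset.sum_le_sum fun y _ => hpoint y).trans ?_
  rw [Finset.sum_add_distrib, Finset.sum_comm, Finset.sum_congr rfl fun j _ => hlaw j,
    Finset.sum_const, Finset.card_range, nsmul_eq_mul, Finset.mul_sum, ← Finset.sum_add_distrib,
    unionBound]
  refine Finset.sum_le_sum fun y _ => ?_
  by_cases hB : B * ∏ n, reachFraction W (y n) < 1
  · rw [if_pos hB, min_eq_right hB.le]
    simp only [hH, if_pos hB]
    have := mul_le_mul_of_nonneg_right hkB (mul_nonneg (hq y) (hs y))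
    linarith
  · rw [if_neg hB, min_eq_left (not_lt.1 hB)]
    simp [hH, if_neg hB]

open Classical in
/-- Given previously chosen words, some word is confused with an earlier one with probability
at most the union bound. -/
lemma exists_word_confusable_le [Nonempty X] {W : X → Y → ℝ} (hW : IsDMC W)
    (hsym : GallagerSymmetric W) (hsing : Singular W) {N k : ℕ} {B : ℝ} (hkB : (k : ℝ) ≤ B)
    (g : ℕ → Fin N → X) :
    ∃ x : Fin N → X, ∑ y : Fin N → Y, (∏ n, W (x n) (y n)) *
      (if ∃ j < k, 0 < ∏ n, W (g j n) (y n) then 1 else 0) ≤ unionBound W N B := by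
  have hcard : (0 : ℝ) < (Fintype.card X : ℝ) ^ N := by positivity
  have havg : ∀ y : Fin N → Y, ∑ x : Fin N → X, ∏ n, W (x n) (y n) =
      (Fintype.card X : ℝ) ^ N * ∏ n, unifOutput W (y n) := by
    intro y
    have h := Finset.prod_univ_sum (fun _ : Fin N => (Finset.univ : Finset X))
      fun n x => W x (y n)
    rw [Fintype.piFinset_univ] at h
    rw [← h]
    simp only [unifOutput, Finset.prod_div_distrib, Finset.prod_const, Finset.card_univ,
      Fintype.card_fin]
    field_simp
  have hle := sum_unifOutput_confusable_le hW hsym hsing hkB g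
  have hsum : ∑ x : Fin N → X, ∑ y : Fin N → Y, (∏ n, W (x n) (y n)) *
      (if ∃ j < k, 0 < ∏ n, W (g j n) (y n) then 1 else 0) ≤
      ∑ _x : Fin N → X, unionBound W N B := by
    rw [Finset.sum_comm, Finset.sum_const, Finset.card_univ, Fintype.card_fun, Fintype.card_fin,
      nsmul_eq_mul]
    push_cast
    calc _ = (Fintype.card X : ℝ) ^ N * ∑ y : Fin N → Y, (∏ n, unifOutput W (y n)) *
          (if ∃ j < k, 0 < ∏ n, W (g j n) (y n) then 1 else 0) := by
          rw [Finset.mul_sum]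
          refine Finset.sum_congr rfl fun y _ => ?_
          rw [← Finset.sum_mul, havg, mul_assoc]
      _ ≤ _ := by gcongr
  obtain ⟨x, -, hx⟩ := Finset.exists_le_of_sum_le Finset.univ_nonempty hsum
  exact ⟨x, hx⟩

open Classical in
/-- Greedy choice of codewords. -/
lemma exists_words_confusable_le [Nonempty X] {W : X → Y → ℝ} (hW : IsDMC W)
    (hsym : GallagerSymmetric W) (hsing : Singular W) (N : ℕ) (B : ℝ) (k : ℕ)
    (hkB : (k : ℝ) ≤ B + 1) :
    ∃ g : ℕ → Fin N → X, ∀ m < k, ∑ y : Fin N → Y, (∏ n, W (g m n) (y n)) *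
      (if ∃ j < m, 0 < ∏ n, W (g j n) (y n) then 1 else 0) ≤ unionBound W N B := by
  induction k with
  | zero => exact ⟨fun _ _ => Classical.arbitrary X, by simp⟩
  | succ k ih =>
    push_cast at hkB
    obtain ⟨g, hg⟩ := ih (by linarith)
    obtain ⟨x, hx⟩ := exists_word_confusable_le (Y := Y) hW hsym hsing
      (show (k : ℝ) ≤ B by linarith) g
    have hlt : ∀ {m}, m ≤ k → ∀ y : Fin N → Y,
        (∃ j < m, 0 < ∏ n, W (Function.update g k x j n) (y n)) ↔
          ∃ j < m, 0 < ∏ n, W (g j n) (y n) := by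
      intro m hm y
      refine exists_congr fun j => and_congr_right fun hj => ?_
      rw [Function.update_of_ne (by omega)]
    refine ⟨Function.update g k x, fun m hm => ?_⟩
    simp only [hlt (Nat.lt_succ_iff.1 hm)]
    rcases (Nat.lt_succ_iff.1 hm).eq_or_lt with rfl | hmk
    · simpa using hx
    · simpa [Function.update_of_ne hmk.ne] using hg m hmk

/-- Codes over singular symmetric channels attain the union bound for every message. -/
lemma exists_code_msgErrorProb_le [Nonempty X] {W : X → Y → ℝ} (hW : IsDMC W)
    (hsym : GallagerSymmetric W) (hsing : Singular W) (N : ℕ) {B : ℝ} {M : ℕ} (hM : 0 < M)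
    (hMB : (M : ℝ) ≤ B + 1) :
    ∃ (f : Fin M → Fin N → X) (φ : (Fin N → Y) → Fin M),
      ∀ m, msgErrorProb W f φ m ≤ unionBound W N B := by
  classical
  obtain ⟨g, hg⟩ := exists_words_confusable_le hW hsym hsing N B M hMB
  have hdec : ∀ y : Fin N → Y, ∃ m₀ : Fin M, ∀ m : Fin M, 0 < ∏ n, W (g m n) (y n) →
      m₀ = m ∨ ∃ j < (m : ℕ), 0 < ∏ n, W (g j n) (y n) := by
    intro y
    by_cases hex : ∃ j, j < M ∧ 0 < ∏ n, W (g j n) (y n)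
    · refine ⟨⟨Nat.find hex, (Nat.find_spec hex).1⟩, fun m hm => ?_⟩
      rcases (Nat.find_min' hex ⟨m.2, hm⟩).eq_or_lt with h | h
      · exact Or.inl (Fin.ext h)
      · exact Or.inr ⟨_, h, (Nat.find_spec hex).2⟩
    · exact ⟨⟨0, hM⟩, fun m hm => (hex ⟨m, m.2, hm⟩).elim⟩
  choose φ hφ using hdec
  refine ⟨fun m => g m, φ, fun m => le_trans ?_ (hg m m.2)⟩
  have hWn : ∀ y : Fin N → Y, 0 ≤ ∏ n, W (g m n) (y n) :=
    fun y => Finset.prod_nonneg fun n _ => hW.1 _ _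
  rw [msgErrorProb, Finset.sum_filter]
  refine Finset.sum_le_sum fun y _ => ?_
  by_cases hy : φ y ≠ m
  · rw [if_pos hy]
    rcases (hWn y).eq_or_lt with h0 | h0
    · rw [← h0, zero_mul]
    · rcases hφ y m h0 with h | h
      · exact (hy h).elim
      · rw [if_pos h, mul_one]
  · rw [if_neg hy]
    exact mul_nonneg (hWn y) (by split_ifs <;> norm_num)

/-- The mass of the uniform output law tilted by `s ^ ρ`; Gallager's function of a singular channel
at the uniform input distribution is
`-log (tiltedMass W ρ)`. -/
noncomputable def tiltedMass (W : X → Y → ℝ) (ρ : ℝ) : ℝ :=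
  ∑ y, unifOutput W y * exp (ρ * log (reachFraction W y))

lemma exists_unifOutput_pos [Nonempty X] {W : X → Y → ℝ} (hW : IsDMC W) :
    ∃ y, 0 < unifOutput W y := by
  by_contra! h
  have h1 := (unifOutput_isProbDist hW).2
  have h2 := Finset.sum_nonpos fun y (_ : y ∈ Finset.univ) => h y
  linarith

lemma tiltedMass_pos [Nonempty X] {W : X → Y → ℝ} (hW : IsDMC W) (ρ : ℝ) :
    0 < tiltedMass W ρ := by
  obtain ⟨y, hy⟩ := exists_unifOutput_pos hW
  exact Finset.sum_pos'
    (fun y _ => mul_nonneg ((unifOutput_isProbDist hW).1 y) (exp_pos _).le)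
    ⟨y, Finset.mem_univ y, mul_pos hy (exp_pos _)⟩

lemma tiltedMass_zero [Nonempty X] {W : X → Y → ℝ} (hW : IsDMC W) : tiltedMass W 0 = 1 := by
  simp [tiltedMass, (unifOutput_isProbDist hW).2]

lemma hasDerivAt_neg_log_tiltedMass [Nonempty X] {W : X → Y → ℝ} (hW : IsDMC W) (ρ : ℝ) :
    HasDerivAt (fun ρ => -log (tiltedMass W ρ))
      (-((∑ y, unifOutput W y * (exp (ρ * log (reachFraction W y)) * log (reachFraction W y))) /
        tiltedMass W ρ)) ρ := by
  refine (HasDerivAt.log ?_ (tiltedMass_pos hW ρ).ne').neg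
  unfold tiltedMass
  refine HasDerivAt.fun_sum fun y _ => HasDerivAt.const_mul _ ?_
  have h : HasDerivAt (fun ρ : ℝ => ρ * log (reachFraction W y)) (log (reachFraction W y)) ρ := by
    simpa using (hasDerivAt_id ρ).mul_const (log (reachFraction W y))
  exact h.exp

lemma min_one_exp_neg_mul_exp_le {ρ c : ℝ} (hc₁ : c ≤ ρ) (hc₂ : c ≤ 1 - ρ) (u : ℝ) :
    min 1 (exp (-u)) * exp (ρ * u) ≤ exp (-(c * |u|)) := by
  rcases le_total 0 u with hu | hu
  · calc min 1 (exp (-u)) * exp (ρ * u) ≤ exp (-u) * exp (ρ * u) := by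
          gcongr
          exact min_le_right _ _
      _ = exp (-u + ρ * u) := (exp_add _ _).symm
      _ ≤ _ := by
          rw [exp_le_exp, abs_of_nonneg hu]
          nlinarith
  · calc min 1 (exp (-u)) * exp (ρ * u) ≤ 1 * exp (ρ * u) := by
          gcongr
          exact min_le_left _ _
      _ ≤ _ := by
          rw [one_mul, exp_le_exp, abs_of_nonpos hu]
          nlinarith

/-- Change of measure for the union bound, followed by the concentration bound under the tilted
law. -/
lemma exists_unionBound_le [Nonempty X] {W : X → Y → ℝ} (hW : IsDMC W) (R : ℝ) {ρ : ℝ}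
    (hρ₀ : 0 < ρ) (hρ₁ : ρ < 1) {y₁ y₂ : Y} (h₁ : 0 < unifOutput W y₁) (h₂ : 0 < unifOutput W y₂)
    (hne : log (reachFraction W y₁) ≠ log (reachFraction W y₂)) :
    ∃ K : ℝ, 0 < K ∧ ∀ N : ℕ, 0 < N → unionBound W N (exp (N * R)) ≤
      K / √N * exp (-(N : ℝ) * (-log (tiltedMass W ρ) - ρ * R)) := by
  set Z := tiltedMass W ρ with hZ
  have hZ0 : 0 < Z := tiltedMass_pos hW ρ
  set p : Y → ℝ := fun y => unifOutput W y * exp (ρ * log (reachFraction W y)) / Z with hp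
  set ξ : Y → ℝ := fun y => -log (reachFraction W y) with hξ
  have hpd : IsProbDist p := by
    refine ⟨fun y => div_nonneg
      (mul_nonneg ((unifOutput_isProbDist hW).1 y) (exp_pos _).le) hZ0.le, ?_⟩
    simp only [hp]
    rw [← Finset.sum_div]
    exact div_self hZ0.ne'
  have hpos : ∀ y, 0 < unifOutput W y → 0 < p y := fun y hy =>
    div_pos (mul_pos hy (exp_pos _)) hZ0
  obtain ⟨K, hK, hbound⟩ := exists_sum_prod_mul_exp_neg_abs_le hpd (ξ := ξ) (hpos _ h₁)
    (hpos _ h₂) (fun h => hne (neg_injective h)) (lt_min hρ₀ (sub_pos.2 hρ₁))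
  refine ⟨K, hK, fun N hN => ?_⟩
  have hfac : exp (-(N : ℝ) * (-log Z - ρ * R)) = Z ^ N * exp (ρ * (N * R)) := by
    rw [← exp_log (pow_pos hZ0 N), log_pow, ← exp_add]
    ring_nf
  have hterm : ∀ y : Fin N → Y,
      (∏ n, unifOutput W (y n)) * min 1 (exp (N * R) * ∏ n, reachFraction W (y n)) ≤
      Z ^ N * exp (ρ * (N * R)) *
        ((∏ n, p (y n)) * exp (-(min ρ (1 - ρ) * |∑ n, ξ (y n) - N * R|))) := by
    intro y
    have hp0 : 0 ≤ ∏ n, p (y n) := Finset.prod_nonneg fun n _ => hpd.1 _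
    by_cases hz : ∃ n, unifOutput W (y n) = 0
    · obtain ⟨n, hn⟩ := hz
      rw [Finset.prod_eq_zero (Finset.mem_univ n) hn, zero_mul]
      positivity
    push Not at hz
    have hs : ∀ n, 0 < reachFraction W (y n) := fun n => by
      obtain ⟨x, hx⟩ := exists_pos_of_unifOutput_pos
        (lt_of_le_of_ne ((unifOutput_isProbDist hW).1 (y n)) (hz n).symm)
      exact reachFraction_pos hx
    have hsprod : ∏ n, reachFraction W (y n) = exp (-∑ n, ξ (y n)) := by
      rw [← Finset.sum_neg_distrib, exp_sum]
      refine Finset.prod_congr rfl fun n _ => ?_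
      simp only [hξ, neg_neg]
      rw [exp_log (hs n)]
    have hqprod : ∏ n, unifOutput W (y n) =
        Z ^ N * (∏ n, p (y n)) * exp (ρ * ∑ n, ξ (y n)) := by
      have hZN : Z ^ N = ∏ _n : Fin N, Z := by simp
      rw [Finset.mul_sum, exp_sum, hZN, ← Finset.prod_mul_distrib, ← Finset.prod_mul_distrib]
      refine Finset.prod_congr rfl fun n _ => ?_
      simp only [hp, hξ]
      rw [mul_div_cancel₀ _ hZ0.ne', mul_assoc, ← exp_add]
      simp
    set u := ∑ n, ξ (y n) - N * R with hu
    have hS : ∑ n, ξ (y n) = N * R + u := by rw [hu]; ring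
    rw [hqprod, hsprod, ← exp_add, hS, mul_add, exp_add,
      show (N : ℝ) * R + -(N * R + u) = -u by ring]
    calc _ = Z ^ N * exp (ρ * (N * R)) * ((∏ n, p (y n)) *
          (min 1 (exp (-u)) * exp (ρ * u))) := by ring
      _ ≤ _ := by
          gcongr
          exact min_one_exp_neg_mul_exp_le (min_le_left _ _) (min_le_right _ _) u
  rw [hfac, unionBound]
  calc _ ≤ Z ^ N * exp (ρ * (N * R)) * ∑ y : Fin N → Y,
        (∏ n, p (y n)) * exp (-(min ρ (1 - ρ) * |∑ n, ξ (y n) - N * R|)) := by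
        rw [Finset.mul_sum]
        exact Finset.sum_le_sum fun y _ => hterm y
    _ ≤ Z ^ N * exp (ρ * (N * R)) * (K / √N) := by
        gcongr
        exact hbound N hN _
    _ = _ := mul_comm _ _

/-- The uniform input distribution. -/
noncomputable def unifDist (X : Type) [Fintype X] (_ : X) : ℝ := (Fintype.card X : ℝ)⁻¹

lemma unifDist_isProbDist (X : Type) [Fintype X] [Nonempty X] : IsProbDist (unifDist X) :=
  ⟨fun _ => by unfold unifDist; positivity, by simp [unifDist]⟩

lemma rpow_tangent_le {a b ρ : ℝ} (ha : 0 ≤ a) (hb : 0 < b) (hρ : 0 ≤ ρ) :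
    b ^ (1 + ρ) + (1 + ρ) * (b ^ ρ * a - b ^ (1 + ρ)) ≤ a ^ (1 + ρ) := by
  have h := one_add_mul_self_le_rpow_one_add (s := a / b - 1)
    (by linarith [div_nonneg ha hb.le]) (p := 1 + ρ) (by linarith)
  rw [add_sub_cancel, div_rpow ha hb.le, le_div_iff₀ (by positivity)] at h
  have hbb : b ^ (1 + ρ) = b * b ^ ρ := by rw [rpow_add hb, rpow_one]
  have : b ^ (1 + ρ) * (a / b) = b ^ ρ * a := by rw [hbb]; field_simp
  calc _ = (1 + (1 + ρ) * (a / b - 1)) * b ^ (1 + ρ) := by rw [← this]; ring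
    _ ≤ _ := h

/-- The inner sum of Gallager's function at the uniform input distribution. -/
lemma sum_unifDist_mul_rpow {W : X → Y → ℝ} (hW : IsDMC W) (hsing : Singular W) {x : X} {y : Y}
    (hx : 0 < W x y) {r : ℝ} (hr : 0 < r) :
    ∑ z, unifDist X z * W z y ^ r = reachFraction W y * W x y ^ r := by
  classical
  have hsum : ∀ z, unifDist X z * W z y ^ r =
      if 0 < W z y then (Fintype.card X : ℝ)⁻¹ * W x y ^ r else 0 := by
    intro z
    split_ifs with hz
    · rw [hsing x z y (mul_pos hx hz), unifDist]
    · rw [le_antisymm (not_lt.1 hz) (hW.1 z y), zero_rpow hr.ne', mul_zero]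
  rw [Finset.sum_congr rfl fun z _ => hsum z, ← Finset.sum_filter, Finset.sum_const,
    nsmul_eq_mul, reachFraction]
  ring_nf

lemma mul_rpow_one_div_rpow [Nonempty X] {W : X → Y → ℝ} (hW : IsDMC W) (hsing : Singular W)
    {x : X} {y : Y} (hx : 0 < W x y) {ρ : ℝ} (hρ : 0 ≤ ρ) :
    (reachFraction W y * W x y ^ (1 / (1 + ρ))) ^ (1 + ρ) =
      unifOutput W y * exp (ρ * log (reachFraction W y)) := by
  have hs := reachFraction_pos hx
  rw [mul_rpow hs.le (by positivity), ← rpow_mul hx.le, one_div_mul_cancel (by positivity),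
    rpow_one, unifOutput_eq_mul_reachFraction hW hsing hx, rpow_add hs, rpow_one,
    rpow_def_of_pos hs, mul_comm ρ]
  ring

lemma Eo_unifDist [Nonempty X] {W : X → Y → ℝ} (hW : IsDMC W) (hsing : Singular W) {ρ : ℝ}
    (hρ : 0 ≤ ρ) : Eo W (unifDist X) ρ = -log (tiltedMass W ρ) := by
  rw [Eo, tiltedMass]
  congr 2
  refine Finset.sum_congr rfl fun y _ => ?_
  by_cases hy : ∃ x, 0 < W x y
  · obtain ⟨x, hx⟩ := hy
    rw [sum_unifDist_mul_rpow hW hsing hx (by positivity), mul_rpow_one_div_rpow hW hsing hx hρ]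
  · push Not at hy
    have h0 : ∀ x, W x y = 0 := fun x => le_antisymm (hy x) (hW.1 x y)
    have h1 : (1 + ρ) ≠ 0 := by positivity
    have h2 : 1 / (1 + ρ) ≠ 0 := by positivity
    simp only [unifOutput, h0, zero_rpow h2, mul_zero, Finset.sum_const_zero, zero_rpow h1,
      zero_div, zero_mul]

/-- The uniform input distribution maximizes Gallager's function. -/
lemma Eo_le_neg_log_tiltedMass [Nonempty X] {W : X → Y → ℝ} (hW : IsDMC W)
    (hsym : GallagerSymmetric W) (hsing : Singular W) {Q : X → ℝ} (hQ : IsProbDist Q) {ρ : ℝ}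
    (hρ : 0 ≤ ρ) : Eo W Q ρ ≤ -log (tiltedMass W ρ) := by
  have h1 : (1 + ρ) ≠ 0 := by positivity
  have h2 : 1 / (1 + ρ) ≠ 0 := by positivity
  set e : Y → ℝ := fun y => exp (ρ * log (reachFraction W y)) with he
  have hpoint : ∀ y, unifOutput W y * e y +
      (1 + ρ) * (∑ x, Q x * (W x y * e y) - unifOutput W y * e y) ≤
      (∑ x, Q x * W x y ^ (1 / (1 + ρ))) ^ (1 + ρ) := by
    intro y
    by_cases hy : ∃ x, 0 < W x y
    · obtain ⟨x, hx⟩ := hy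
      have hs := reachFraction_pos hx
      set b := reachFraction W y * W x y ^ (1 / (1 + ρ)) with hb
      have hb0 : 0 < b := by positivity
      have hbρ : b ^ (1 + ρ) = unifOutput W y * e y := mul_rpow_one_div_rpow hW hsing hx hρ
      have hterm : ∀ z, b ^ ρ * (Q z * W z y ^ (1 / (1 + ρ))) = Q z * (W z y * e y) := by
        intro z
        rcases (hW.1 z y).eq_or_lt with hz | hz
        · rw [← hz, zero_rpow h2]; ring
        · rw [← hsing x z y (mul_pos hx hz)]
          have hbw : b ^ ρ * b = unifOutput W y * e y := by
            rw [← hbρ, rpow_add hb0, rpow_one, mul_comm]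
          rw [unifOutput_eq_mul_reachFraction hW hsing hx] at hbw
          have : b ^ ρ * W x y ^ (1 / (1 + ρ)) = W x y * e y := by
            apply mul_left_cancel₀ hs.ne'
            rw [hb] at hbw ⊢
            linear_combination hbw
          linear_combination Q z * this
      have ha : 0 ≤ ∑ z, Q z * W z y ^ (1 / (1 + ρ)) :=
        Finset.sum_nonneg fun z _ => mul_nonneg (hQ.1 z) (rpow_nonneg (hW.1 z y) _)
      have := rpow_tangent_le ha hb0 hρ
      rwa [hbρ, Finset.mul_sum, Finset.sum_congr rfl fun z _ => hterm z] at this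
    · push Not at hy
      have h0 : ∀ x, W x y = 0 := fun x => le_antisymm (hy x) (hW.1 x y)
      simp [unifOutput, h0, zero_rpow h1, inv_ne_zero h1]
  have hmix : ∑ y, ∑ x, Q x * (W x y * e y) = tiltedMass W ρ := by
    rw [Finset.sum_comm]
    have : ∀ x, ∑ y, Q x * (W x y * e y) = Q x * tiltedMass W ρ := fun x => by
      rw [← Finset.mul_sum, tiltedMass,
        sum_mul_comp_reachFraction hsym (fun s => exp (ρ * log s)) x]
    rw [Finset.sum_congr rfl fun x _ => this x, ← Finset.sum_mul, hQ.2, one_mul]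
  rw [Eo, neg_le_neg_iff]
  refine log_le_log (tiltedMass_pos hW ρ) ?_
  calc tiltedMass W ρ = ∑ y, (unifOutput W y * e y +
      (1 + ρ) * (∑ x, Q x * (W x y * e y) - unifOutput W y * e y)) := by
        rw [Finset.sum_add_distrib, ← Finset.mul_sum, Finset.sum_sub_distrib, hmix]
        simp [tiltedMass, he]
    _ ≤ _ := Finset.sum_le_sum fun y _ => hpoint y

/-- The uniform input distribution maximizes the mutual information. -/
lemma capacity_le [Nonempty X] {W : X → Y → ℝ} (hW : IsDMC W) (hsym : GallagerSymmetric W)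
    (hsing : Singular W) :
    capacity W ≤ -∑ y, unifOutput W y * log (reachFraction W y) := by
  refine csSup_le ⟨_, unifDist X, unifDist_isProbDist X, rfl⟩ ?_
  rintro _ ⟨Q, hQ, rfl⟩
  set o : Y → ℝ := fun y => ∑ z, Q z * W z y with ho
  have hWo : ∀ x y, 0 < Q x → 0 < W x y → 0 < o y := fun x y hx hy =>
    lt_of_lt_of_le (mul_pos hx hy) (Finset.single_le_sum (f := fun z => Q z * W z y)
      (fun z _ => mul_nonneg (hQ.1 z) (hW.1 z y)) (Finset.mem_univ x))
  have hterm : ∀ x y, Q x * W x y * log (W x y / o y) ≤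
      Q x * (W x y * -log (reachFraction W y)) +
        (Q x * W x y * (unifOutput W y / o y) - Q x * W x y) := by
    intro x y
    rcases (hQ.1 x).eq_or_lt with hx | hx
    · simp [← hx]
    rcases (hW.1 x y).eq_or_lt with hy | hy
    · simp [← hy]
    have hs := reachFraction_pos hy
    have hoy := hWo x y hx hy
    have hq := unifOutput_eq_mul_reachFraction hW hsing hy
    have hq0 : 0 < unifOutput W y := by rw [hq]; positivity
    have hl := log_le_sub_one_of_pos (div_pos hq0 hoy)
    have hlog : log (W x y / o y) = -log (reachFraction W y) + log (unifOutput W y / o y) := by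
      rw [hq, log_div (by positivity) hoy.ne', log_div (by positivity) hoy.ne',
        log_mul hy.ne' hs.ne']
      ring
    rw [hlog]
    have := mul_le_mul_of_nonneg_left hl (mul_pos hx hy).le
    linarith
  have hsum1 : ∑ x, ∑ y, Q x * (W x y * -log (reachFraction W y)) =
      -∑ y, unifOutput W y * log (reachFraction W y) := by
    have : ∀ x, ∑ y, Q x * (W x y * -log (reachFraction W y)) =
        Q x * -∑ y, unifOutput W y * log (reachFraction W y) := fun x => by
      rw [← Finset.mul_sum, sum_mul_comp_reachFraction hsym (fun s => -log s) x]
      simp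
    rw [Finset.sum_congr rfl fun x _ => this x, ← Finset.sum_mul, hQ.2, one_mul]
  have hsum2 : ∑ x, ∑ y, Q x * W x y = 1 := by
    simp [← Finset.mul_sum, hW.2, hQ.2]
  have hsum3 : ∑ x, ∑ y, Q x * W x y * (unifOutput W y / o y) ≤ 1 := by
    rw [Finset.sum_comm, ← (unifOutput_isProbDist hW).2]
    refine Finset.sum_le_sum fun y _ => ?_
    rw [← Finset.sum_mul]
    rcases eq_or_ne (o y) 0 with h0 | h0
    · rw [h0]; simpa using (unifOutput_isProbDist hW).1 y
    · exact (mul_div_cancel₀ _ h0).le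
  calc mutualInfo W Q ≤ ∑ x, ∑ y, (Q x * (W x y * -log (reachFraction W y)) +
        (Q x * W x y * (unifOutput W y / o y) - Q x * W x y)) :=
        Finset.sum_le_sum fun x _ => Finset.sum_le_sum fun y _ => hterm x y
    _ ≤ _ := by
        simp only [Finset.sum_add_distrib, Finset.sum_sub_distrib]
        rw [hsum1, hsum2]
        linarith

lemma neg_log_tiltedMass_le [Nonempty X] {W : X → Y → ℝ} (hW : IsDMC W) {ρ : ℝ} (hρ : 0 ≤ ρ) :
    -log (tiltedMass W ρ) ≤ ρ * log (Fintype.card X) := by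
  rw [neg_le, le_log_iff_exp_le (tiltedMass_pos hW ρ)]
  calc exp (-(ρ * log (Fintype.card X))) =
      ∑ y, unifOutput W y * exp (-(ρ * log (Fintype.card X))) := by
        rw [← Finset.sum_mul, (unifOutput_isProbDist hW).2, one_mul]
    _ ≤ _ := by
        refine Finset.sum_le_sum fun y _ => ?_
        rcases ((unifOutput_isProbDist hW).1 y).eq_or_lt with h | h
        · simp [← h]
        obtain ⟨x, hx⟩ := exists_pos_of_unifOutput_pos h
        have hlog := log_le_log (by positivity) (inv_card_le_reachFraction hx)
        rw [log_inv] at hlog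
        gcongr
        nlinarith

lemma Er_eq_of_forall_le [Nonempty X] {W : X → Y → ℝ} (hW : IsDMC W) (hsym : GallagerSymmetric W)
    (hsing : Singular W) {R ρ : ℝ} (hρ : ρ ∈ Set.Icc (0 : ℝ) 1)
    (hmax : ∀ ρ' ∈ Set.Icc (0 : ℝ) 1,
      -log (tiltedMass W ρ') - ρ' * R ≤ -log (tiltedMass W ρ) - ρ * R) :
    Er W R = -log (tiltedMass W ρ) - ρ * R := by
  refine IsGreatest.csSup_eq
    ⟨⟨unifDist X, unifDist_isProbDist X, ρ, hρ.1, hρ.2, by rw [Eo_unifDist hW hsing hρ.1]⟩, ?_⟩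
  rintro _ ⟨Q, hQ, ρ', h0, h1, rfl⟩
  linarith [hmax ρ' ⟨h0, h1⟩, Eo_le_neg_log_tiltedMass hW hsym hsing hQ h0]

lemma neg_log_tiltedMass_sub_mem_ESPset [Nonempty X] {W : X → Y → ℝ} (hW : IsDMC W)
    (hsing : Singular W) (R : ℝ) {ρ : ℝ} (hρ : 0 ≤ ρ) :
    -log (tiltedMass W ρ) - ρ * R ∈ ESPset W R :=
  ⟨unifDist X, unifDist_isProbDist X, ρ, hρ, by rw [Eo_unifDist hW hsing hρ]⟩

/-- Above `log |X|` both exponents vanish. -/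
lemma Er_eq_ESP_of_log_card_le [Nonempty X] {W : X → Y → ℝ} (hW : IsDMC W)
    (hsym : GallagerSymmetric W) (hsing : Singular W) {R : ℝ} (hR : log (Fintype.card X) ≤ R) :
    Er W R = ESP W R := by
  have h0 : -log (tiltedMass W 0) - 0 * R = 0 := by simp [tiltedMass_zero hW]
  have hle : ∀ ρ, 0 ≤ ρ → -log (tiltedMass W ρ) - ρ * R ≤ 0 := fun ρ hρ => by
    have := neg_log_tiltedMass_le hW hρ
    have := mul_le_mul_of_nonneg_left hR hρ
    linarith
  rw [Er_eq_of_forall_le hW hsym hsing (ρ := 0) (by simp)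
    (fun ρ' h => by rw [h0]; exact hle ρ' h.1)]
  symm
  refine IsGreatest.csSup_eq ⟨neg_log_tiltedMass_sub_mem_ESPset hW hsing R le_rfl, ?_⟩
  rintro _ ⟨Q, hQ, ρ, hρ, rfl⟩
  rw [h0]
  linarith [hle ρ hρ, Eo_le_neg_log_tiltedMass hW hsym hsing hQ hρ]

lemma exists_isMax_neg_log_tiltedMass_sub [Nonempty X] {W : X → Y → ℝ} (hW : IsDMC W) (R : ℝ) :
    ∃ ρ ∈ Set.Icc (0 : ℝ) 1, ∀ ρ' ∈ Set.Icc (0 : ℝ) 1,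
      -log (tiltedMass W ρ') - ρ' * R ≤ -log (tiltedMass W ρ) - ρ * R := by
  have hcont : Continuous fun ρ => -log (tiltedMass W ρ) - ρ * R :=
    Continuous.sub
      (continuous_iff_continuousAt.2 fun ρ => (hasDerivAt_neg_log_tiltedMass hW ρ).continuousAt)
      (by fun_prop)
  obtain ⟨ρ, hρ, hmax⟩ := isCompact_Icc.exists_isMaxOn (Set.nonempty_Icc.2 zero_le_one)
    hcont.continuousOn
  exact ⟨ρ, hρ, fun ρ' h => hmax h⟩

lemma HasDerivAt.le_of_forall_right {F : ℝ → ℝ} {d a r : ℝ} (hF : HasDerivAt F d a)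
    (h : ∀ x, a < x → x ≤ a + 1 → F x ≤ F a + (x - a) * r) : d ≤ r := by
  have ht := (hasDerivWithinAt_iff_tendsto_slope' (by simp)).1
    (hF.hasDerivWithinAt (s := Set.Ioi a))
  refine le_of_tendsto ht ?_
  filter_upwards [Ioc_mem_nhdsGT (show a < a + 1 by linarith)] with x hx
  rw [slope_def_field, div_le_iff₀ (by linarith [hx.1])]
  linarith [h x hx.1 hx.2]

lemma HasDerivAt.le_of_forall_left {F : ℝ → ℝ} {d a r : ℝ} (hF : HasDerivAt F d a)
    (h : ∀ x, a - 1 ≤ x → x < a → F x ≤ F a + (x - a) * r) : r ≤ d := by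
  have ht := (hasDerivWithinAt_iff_tendsto_slope' (by simp)).1
    (hF.hasDerivWithinAt (s := Set.Iio a))
  refine ge_of_tendsto ht ?_
  filter_upwards [Ico_mem_nhdsLT (show a - 1 < a by linarith)] with x hx
  rw [slope_def_field, le_div_iff_of_neg (by linarith [hx.2])]
  linarith [h x hx.1 hx.2]

/-- Between the critical rate and capacity the random coding exponent is attained at an interior
`ρ`, and the reachable fraction is not almost surely constant. -/
lemma exists_interior_optimum [Nonempty X] {W : X → Y → ℝ} (hW : IsDMC W)
    (hsym : GallagerSymmetric W) (hsing : Singular W) {R : ℝ} (hR₁ : Rcr W < R)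
    (hR₂ : R < capacity W) :
    ∃ ρ, 0 < ρ ∧ ρ < 1 ∧ Er W R = -log (tiltedMass W ρ) - ρ * R ∧
      ∃ y₁ y₂, 0 < unifOutput W y₁ ∧ 0 < unifOutput W y₂ ∧
        log (reachFraction W y₁) ≠ log (reachFraction W y₂) := by
  set F : ℝ → ℝ := fun ρ => -log (tiltedMass W ρ) with hF
  set I := -∑ y, unifOutput W y * log (reachFraction W y) with hI
  have hRI : R < I := hR₂.trans_le (capacity_le hW hsym hsing)
  have hF0 : F 0 = 0 := by simp [hF, tiltedMass_zero hW]
  have hd0 : HasDerivAt F I 0 := by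
    have := hasDerivAt_neg_log_tiltedMass hW 0
    simpa [tiltedMass_zero hW] using this
  have hstart : ∀ r < I, ¬ ∀ ρ ∈ Set.Icc (0 : ℝ) 1, F ρ - ρ * r ≤ 0 := by
    intro r hr hall
    refine hr.not_ge (hd0.le_of_forall_right fun x hx0 hx1 => ?_)
    have := hall x ⟨hx0.le, by linarith⟩
    rw [hF0]
    linarith
  obtain ⟨R₀, hR₀, hR₀R⟩ := exists_lt_of_csInf_lt
    (s := {R | ∀ R', R ≤ R' → Er W R' = ESP W R'})
    ⟨log (Fintype.card X), fun R' h => Er_eq_ESP_of_log_card_le hW hsym hsing h⟩ hR₁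
  obtain ⟨ρ₀, hρ₀, hmax₀⟩ := exists_isMax_neg_log_tiltedMass_sub hW R₀
  have hEr₀ := Er_eq_of_forall_le hW hsym hsing hρ₀ hmax₀
  have hESP₀ : Er W R₀ = ESP W R₀ := hR₀ R₀ le_rfl
  have hbdd : BddAbove (ESPset W R₀) := by
    by_contra hnot
    rw [ESP, Real.sSup_of_not_bddAbove hnot] at hESP₀
    refine hstart R₀ (hR₀R.trans hRI) fun ρ hρ => ?_
    linarith [hmax₀ ρ hρ]
  have hglob : ∀ ρ, 0 ≤ ρ → F ρ - ρ * R₀ ≤ F ρ₀ - ρ₀ * R₀ := by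
    intro ρ hρ
    have h := le_csSup hbdd (neg_log_tiltedMass_sub_mem_ESPset hW hsing R₀ hρ)
    rw [← ESP, ← hESP₀, hEr₀] at h
    exact h
  obtain ⟨ρ, hρ, hmax⟩ := exists_isMax_neg_log_tiltedMass_sub hW R
  have hpos : 0 < ρ := by
    refine lt_of_le_of_ne hρ.1 fun h => hstart R hRI fun ρ' hρ' => ?_
    have := hmax ρ' hρ'
    rw [← h] at this
    change F ρ' - ρ' * R ≤ F 0 - 0 * R at this
    linarith
  have hlt : ρ < 1 := by
    refine lt_of_le_of_ne hρ.2 fun h => ?_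
    subst h
    have hρ₀1 : ρ₀ = 1 := by
      refine le_antisymm hρ₀.2 ?_
      by_contra! hlt
      have h1 : F ρ₀ - ρ₀ * R ≤ F 1 - 1 * R := hmax ρ₀ hρ₀
      have h2 := hglob 1 zero_le_one
      nlinarith
    subst hρ₀1
    have hd1 : HasDerivAt F _ 1 := hasDerivAt_neg_log_tiltedMass hW 1
    have hle := hd1.le_of_forall_right (r := R₀) fun x hx _ => by
      linarith [hglob x (by linarith)]
    have hge := hd1.le_of_forall_left (r := R) fun x hx0 hx1 => by
      have : F x - x * R ≤ F 1 - 1 * R := hmax x ⟨by linarith, hx1.le⟩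
      linarith
    linarith
  refine ⟨ρ, hpos, hlt, Er_eq_of_forall_le hW hsym hsing hρ hmax, ?_⟩
  by_contra! hconst
  obtain ⟨y₀, hy₀⟩ := exists_unifOutput_pos hW
  have hsubst : ∀ h : ℝ → ℝ, ∑ y, unifOutput W y * h (log (reachFraction W y)) =
      h (log (reachFraction W y₀)) := by
    intro h
    rw [← one_mul (h _), ← (unifOutput_isProbDist hW).2, Finset.sum_mul]
    refine Finset.sum_congr rfl fun y _ => ?_
    rcases ((unifOutput_isProbDist hW).1 y).eq_or_lt with h0 | h0
    · simp [← h0]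
    · rw [hconst y y₀ h0 hy₀]
  have hlin : ∀ r, F r = r * I := fun r => by
    simp only [hF, tiltedMass]
    rw [hsubst fun l => exp (r * l), log_exp, hI, hsubst fun l => l]
    ring
  have h1 : F 1 - 1 * R ≤ F ρ - ρ * R := hmax 1 (by simp)
  rw [hlin, hlin] at h1
  nlinarith

/-- **Theorem 2(i)** (singular achievability): for a symmetric singular DMC with `R_cr < C(W)`
and any rate `R_cr < R < C(W)`, there is a constant `K₂ > 0` such that for every blocklength
`N ≥ 1` there is an `(N,R)` code whose maximal error probability is at most
`(K₂/√N) · exp(-N E_r(R))`. -/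
theorem statement2 {X Y : Type} [Fintype X] [Fintype Y] [Nonempty X] [Nonempty Y]
    (W : X → Y → ℝ) (hW : IsDMC W) (hsym : GallagerSymmetric W) (hsing : Singular W)
    (hcr : Rcr W < capacity W)
    (R : ℝ) (hR1 : Rcr W < R) (hR2 : R < capacity W) :
    ∃ K₂ : ℝ, 0 < K₂ ∧ ∀ N : ℕ, 0 < N →
      ∃ (f : Fin (Mof N R) → Fin N → X) (φ : (Fin N → Y) → Fin (Mof N R)),
        ∀ m, msgErrorProb W f φ m ≤
          K₂ / Real.sqrt N * Real.exp (-(N : ℝ) * Er W R) := by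
  obtain ⟨ρ, hρ₀, hρ₁, hEr, y₁, y₂, h₁, h₂, hne⟩ :=
    exists_interior_optimum hW hsym hsing hR1 hR2
  obtain ⟨K, hK, hbound⟩ := exists_unionBound_le hW R hρ₀ hρ₁ h₁ h₂ hne
  refine ⟨K, hK, fun N hN => ?_⟩
  obtain ⟨f, φ, hf⟩ := exists_code_msgErrorProb_le hW hsym hsing N
    (Nat.ceil_pos.2 (exp_pos (N * R))) (Nat.ceil_lt_add_one (exp_pos (N * R)).le).le
  exact ⟨f, φ, fun m => (hf m).trans (hEr ▸ hbound N hN)⟩
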